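/- Let S = {s_n : n ∈ ℕ₀} ⊂ (0,1] be a strictly decreasing sequence converging to 0 whose consecutive distances s_n − s_{n+1} are eventually decreasing, and suppose the box dimension dim_B S exists. Let r > 0 and let H_{r,S} = {(x,y) ∈ (0,1] × (0,1] : x^r y = c for some c ∈ S} be the corresponding family of hyperbolas. Then the box dimension of H_{r,S} exists and equals 1 + dim_B S if r ≤ 1, and 1 + dim_B(S^{1/r}) if r > 1, where S^{1/r} = {c^{1/r} : c ∈ S} (whose box dimension exists as well in that case). -/

import Mathlib

open Filter MeasureTheory Metric Set Real

/-- Lower box dimension of `U ⊆ X`, with ambient dimension `N`, defined through the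
Lebesgue measure of `ε`-neighborhoods:
`inf {d ≥ 0 : liminf_{ε→0⁺} |U_ε| / ε^{N−d} = 0}`. -/
noncomputable def lowerBoxDim {X : Type*} [PseudoEMetricSpace X] [MeasureSpace X]
    (N : ℝ) (U : Set X) : ℝ :=
  sInf {d : ℝ | 0 ≤ d ∧
    Filter.liminf
      (fun ε : ℝ => volume (Metric.thickening ε U) / ENNReal.ofReal (ε ^ (N - d)))
      (nhdsWithin 0 (Set.Ioi 0)) = 0}

/-- Upper box dimension, defined with `limsup` instead of `liminf`. -/
noncomputable def upperBoxDim {X : Type*} [PseudoEMetricSpace X] [MeasureSpace X]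
    (N : ℝ) (U : Set X) : ℝ :=
  sInf {d : ℝ | 0 ≤ d ∧
    Filter.limsup
      (fun ε : ℝ => volume (Metric.thickening ε U) / ENNReal.ofReal (ε ^ (N - d)))
      (nhdsWithin 0 (Set.Ioi 0)) = 0}

/-- The set `U ⊆ X` has box dimension `d`. -/
def HasBoxDim {X : Type*} [PseudoEMetricSpace X] [MeasureSpace X]
    (N : ℝ) (U : Set X) (d : ℝ) : Prop :=
  lowerBoxDim N U = d ∧ upperBoxDim N U = d

section BoxDim

variable {X : Type*} [PseudoEMetricSpace X] [MeasureSpace X]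

/-- The volume of the `ε`-neighborhood of `U` is at most of order `ε ^ (N - δ)`. -/
def HasUpperContent (N : ℝ) (U : Set X) (δ : ℝ) : Prop :=
  ∃ C : ℝ, ∀ ε ∈ Ioc (0 : ℝ) 1, volume (thickening ε U) ≤ ENNReal.ofReal (C * ε ^ (N - δ))

/-- The volume of the `ε`-neighborhood of `U` is at least of order `ε ^ (N - δ)`. -/
def HasLowerContent (N : ℝ) (U : Set X) (δ : ℝ) : Prop :=
  ∃ c > 0, ∀ ε ∈ Ioc (0 : ℝ) 1, ENNReal.ofReal (c * ε ^ (N - δ)) ≤ volume (thickening ε U)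

lemma HasUpperContent.tendsto {N : ℝ} {U : Set X} {δ d : ℝ} (h : HasUpperContent N U δ)
    (hd : δ < d) :
    Tendsto (fun ε : ℝ => volume (thickening ε U) / ENNReal.ofReal (ε ^ (N - d)))
      (nhdsWithin 0 (Ioi 0)) (nhds 0) := by
  obtain ⟨C, hC⟩ := h
  have hpow : Tendsto (fun ε : ℝ => ENNReal.ofReal (C * ε ^ (d - δ)))
      (nhdsWithin 0 (Ioi 0)) (nhds 0) := by
    have h1 : Tendsto (fun ε : ℝ => C * ε ^ (d - δ)) (nhds 0) (nhds (C * 0 ^ (d - δ))) :=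
      ((Real.continuousAt_rpow_const _ _ (Or.inr (by linarith))).tendsto).const_mul C
    have h2 := ENNReal.tendsto_ofReal h1
    rw [Real.zero_rpow (by linarith), mul_zero, ENNReal.ofReal_zero] at h2
    exact h2.mono_left nhdsWithin_le_nhds
  refine tendsto_of_tendsto_of_tendsto_of_le_of_le' tendsto_const_nhds hpow
    (Eventually.of_forall fun _ => zero_le) ?_
  filter_upwards [Ioc_mem_nhdsGT one_pos] with ε hε
  have hp : 0 < ε ^ (N - d) := Real.rpow_pos_of_pos hε.1 _
  refine ENNReal.div_le_of_le_mul ((hC ε hε).trans (le_of_eq ?_))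
  rw [← ENNReal.ofReal_mul' hp.le, mul_assoc, ← Real.rpow_add hε.1]
  ring_nf

lemma HasLowerContent.liminf_ne_zero {N : ℝ} {U : Set X} {δ d : ℝ}
    (h : HasLowerContent N U δ) (hd : d ≤ δ) :
    liminf (fun ε : ℝ => volume (thickening ε U) / ENNReal.ofReal (ε ^ (N - d)))
      (nhdsWithin 0 (Ioi 0)) ≠ 0 := by
  obtain ⟨c, hc, hC⟩ := h
  refine (lt_of_lt_of_le (ENNReal.ofReal_pos.2 hc) (le_liminf_of_le ?_ ?_)).ne'
  · isBoundedDefault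
  filter_upwards [Ioc_mem_nhdsGT one_pos] with ε hε
  have hp : 0 < ε ^ (N - d) := Real.rpow_pos_of_pos hε.1 _
  rw [ENNReal.le_div_iff_mul_le (Or.inl (by simpa using hp)) (Or.inl ENNReal.ofReal_ne_top),
    ← ENNReal.ofReal_mul hc.le]
  refine le_trans (ENNReal.ofReal_le_ofReal ?_) (hC ε hε)
  exact mul_le_mul_of_nonneg_left
    (Real.rpow_le_rpow_of_exponent_ge hε.1 hε.2 (by linarith)) hc.le

lemma hasUpperContent_self {N : ℝ} {U : Set X} (hfin : volume (thickening 1 U) ≠ ⊤) :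
    HasUpperContent N U N := by
  refine ⟨(volume (thickening 1 U)).toReal, fun ε hε => ?_⟩
  rw [sub_self, Real.rpow_zero, mul_one, ENNReal.ofReal_toReal hfin]
  exact measure_mono (thickening_mono hε.2 U)

lemma HasUpperContent.of_limsup {N : ℝ} {U : Set X} (hfin : volume (thickening 1 U) ≠ ⊤)
    {δ d : ℝ} (hd : d ≤ δ) (hδ : δ ≤ N)
    (h : limsup (fun ε : ℝ => volume (thickening ε U) / ENNReal.ofReal (ε ^ (N - d)))
      (nhdsWithin 0 (Ioi 0)) = 0) : HasUpperContent N U δ := by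
  have hev := eventually_lt_of_limsup_lt (h.trans_lt one_pos)
  obtain ⟨e, he, hsub⟩ := mem_nhdsGT_iff_exists_Ioo_subset.1 hev
  have he : 0 < e := he
  set W := (volume (thickening 1 U)).toReal with hW
  have hW0 : 0 ≤ W := ENNReal.toReal_nonneg
  refine ⟨max 1 (W * (e ^ (N - δ))⁻¹), fun ε hε => ?_⟩
  have hp : 0 < ε ^ (N - d) := Real.rpow_pos_of_pos hε.1 _
  have hq : 0 < ε ^ (N - δ) := Real.rpow_pos_of_pos hε.1 _
  rcases lt_or_ge ε e with hlt | hge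
  · have h1 : volume (thickening ε U) / ENNReal.ofReal (ε ^ (N - d)) < 1 := hsub ⟨hε.1, hlt⟩
    rw [ENNReal.div_lt_iff (Or.inl (by simpa using hp)) (Or.inl ENNReal.ofReal_ne_top),
      one_mul] at h1
    refine h1.le.trans (ENNReal.ofReal_le_ofReal ?_)
    calc ε ^ (N - d) ≤ 1 * ε ^ (N - δ) := by
          rw [one_mul]
          exact Real.rpow_le_rpow_of_exponent_ge hε.1 hε.2 (by linarith)
      _ ≤ _ := mul_le_mul_of_nonneg_right (le_max_left _ _) hq.le
  · refine (measure_mono (thickening_mono hε.2 U)).trans ?_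
    rw [← ENNReal.ofReal_toReal hfin]
    refine ENNReal.ofReal_le_ofReal ?_
    have hep : 0 < e ^ (N - δ) := Real.rpow_pos_of_pos he _
    calc W = W * (e ^ (N - δ))⁻¹ * e ^ (N - δ) := by field_simp
      _ ≤ W * (e ^ (N - δ))⁻¹ * ε ^ (N - δ) :=
          mul_le_mul_of_nonneg_left (Real.rpow_le_rpow he.le hge (by linarith)) (by positivity)
      _ ≤ _ := mul_le_mul_of_nonneg_right (le_max_right _ _) hq.le

lemma HasLowerContent.of_liminf {N : ℝ} {U : Set X} (hfin : volume (thickening 1 U) ≠ ⊤)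
    (hpos : ∀ ε > 0, 0 < volume (thickening ε U)) {δ : ℝ} (hδ : δ ≤ N)
    (h : liminf (fun ε : ℝ => volume (thickening ε U) / ENNReal.ofReal (ε ^ (N - δ)))
      (nhdsWithin 0 (Ioi 0)) ≠ 0) : HasLowerContent N U δ := by
  obtain ⟨c, hc0, hc⟩ := ENNReal.lt_iff_exists_nnreal_btwn.1 (pos_iff_ne_zero.2 h)
  have hev := eventually_lt_of_lt_liminf hc
  obtain ⟨e, he, hsub⟩ := mem_nhdsGT_iff_exists_Ioo_subset.1 hev
  have he : 0 < e := he
  set f := min (e / 2) 1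
  have hf : 0 < f := by positivity
  have hf1 : f ≤ 1 := min_le_right _ _
  set W := (volume (thickening f U)).toReal with hW
  have hWf : volume (thickening f U) ≠ ⊤ :=
    ne_top_of_le_ne_top hfin (measure_mono (thickening_mono hf1 U))
  have hW0 : 0 < W := ENNReal.toReal_pos (hpos f hf).ne' hWf
  have hc0' : 0 < (c : ℝ) := by exact_mod_cast hc0
  refine ⟨min c W, lt_min hc0' hW0, fun ε hε => ?_⟩
  have hq : 0 < ε ^ (N - δ) := Real.rpow_pos_of_pos hε.1 _
  rcases lt_or_ge ε e with hlt | hge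
  · have h1 : (c : ENNReal) < volume (thickening ε U) / ENNReal.ofReal (ε ^ (N - δ)) :=
      hsub ⟨hε.1, hlt⟩
    rw [ENNReal.lt_div_iff_mul_lt (Or.inl (by simpa using hq))
      (Or.inl ENNReal.ofReal_ne_top), ← ENNReal.ofReal_coe_nnreal,
      ← ENNReal.ofReal_mul hc0'.le] at h1
    exact le_trans (ENNReal.ofReal_le_ofReal
      (mul_le_mul_of_nonneg_right (min_le_left _ _) hq.le)) h1.le
  · have hfe : f ≤ ε := (min_le_left _ _).trans (by linarith)
    refine le_trans ?_ (measure_mono (thickening_mono hfe U))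
    rw [← ENNReal.ofReal_toReal hWf]
    refine ENNReal.ofReal_le_ofReal ?_
    calc min (c : ℝ) W * ε ^ (N - δ) ≤ W * 1 :=
          mul_le_mul (min_le_right _ _)
            (Real.rpow_le_one hε.1.le hε.2 (by linarith)) hq.le hW0.le
      _ = _ := mul_one _

lemma HasLowerContent.mono {N : ℝ} {U : Set X} {δ d : ℝ} (h : HasLowerContent N U δ)
    (hd : d ≤ δ) : HasLowerContent N U d := by
  obtain ⟨c, hc, h⟩ := h
  refine ⟨c, hc, fun ε hε => le_trans (ENNReal.ofReal_le_ofReal ?_) (h ε hε)⟩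
  exact mul_le_mul_of_nonneg_left
    (Real.rpow_le_rpow_of_exponent_ge hε.1 hε.2 (by linarith)) hc.le

/-- The box dimension read off from power bounds on the volume of the neighborhoods. -/
lemma hasBoxDim_iff {N : ℝ} (hN : 0 ≤ N) {U : Set X} (hfin : volume (thickening 1 U) ≠ ⊤)
    (hpos : ∀ ε > 0, 0 < volume (thickening ε U)) {D : ℝ} :
    HasBoxDim N U D ↔ D ∈ Icc 0 N ∧
      (∀ δ ∈ Ioo D N, HasUpperContent N U δ) ∧ ∀ δ ∈ Ioo 0 D, HasLowerContent N U δ := by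
  set A := {d : ℝ | 0 ≤ d ∧ liminf (fun ε : ℝ => volume (thickening ε U) /
    ENNReal.ofReal (ε ^ (N - d))) (nhdsWithin 0 (Ioi 0)) = 0} with hA
  set B := {d : ℝ | 0 ≤ d ∧ limsup (fun ε : ℝ => volume (thickening ε U) /
    ENNReal.ofReal (ε ^ (N - d))) (nhdsWithin 0 (Ioi 0)) = 0} with hB
  have hdef : HasBoxDim N U D ↔ sInf A = D ∧ sInf B = D := Iff.rfl
  rw [hdef]
  have hA0 : ∀ d ∈ A, 0 ≤ d := fun d hd => hd.1
  have hB0 : ∀ d ∈ B, 0 ≤ d := fun d hd => hd.1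
  have hAbdd : BddBelow A := ⟨0, hA0⟩
  have hBbdd : BddBelow B := ⟨0, hB0⟩
  have hmemB : ∀ d > N, d ∈ B := fun d hd =>
    ⟨hN.trans hd.le, ((hasUpperContent_self hfin).tendsto hd).limsup_eq⟩
  constructor
  · rintro ⟨h1, h2⟩
    refine ⟨⟨h1 ▸ Real.sInf_nonneg hA0, ?_⟩, fun δ hδ => ?_, fun δ hδ => ?_⟩
    · exact le_of_forall_gt_imp_ge_of_dense fun d hd => h2 ▸ csInf_le hBbdd (hmemB d hd)
    · obtain ⟨d, hd, hlt⟩ := (csInf_lt_iff hBbdd ⟨N + 1, hmemB _ (by linarith)⟩).1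
        (h2.trans_lt hδ.1)
      exact HasUpperContent.of_limsup hfin hlt.le hδ.2.le hd.2
    · have hDN : D ≤ N :=
        le_of_forall_gt_imp_ge_of_dense fun d hd => h2 ▸ csInf_le hBbdd (hmemB d hd)
      refine HasLowerContent.of_liminf hfin hpos (hδ.2.le.trans hDN) fun h => ?_
      have : D ≤ δ := h1 ▸ csInf_le hAbdd ⟨hδ.1.le, h⟩
      exact absurd hδ.2 (not_lt.2 this)
  · rintro ⟨⟨hD0, hDN⟩, hup, hlow⟩
    have hup' : ∀ d > D, Tendsto (fun ε : ℝ => volume (thickening ε U) /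
        ENNReal.ofReal (ε ^ (N - d))) (nhdsWithin 0 (Ioi 0)) (nhds 0) := by
      intro d hd
      rcases hDN.eq_or_lt with rfl | hlt
      · exact (hasUpperContent_self hfin).tendsto hd
      · have h1 : D < min d N := lt_min hd hlt
        have h2 := min_le_left d N
        have h3 := min_le_right d N
        exact (hup ((D + min d N) / 2) ⟨by linarith, by linarith⟩).tendsto (by linarith)
    have hlow' : ∀ d ≥ 0, d < D → liminf (fun ε : ℝ => volume (thickening ε U) /
        ENNReal.ofReal (ε ^ (N - d))) (nhdsWithin 0 (Ioi 0)) ≠ 0 := fun d hd hdD =>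
      (hlow ((d + D) / 2) ⟨by linarith, by linarith⟩).liminf_ne_zero (by linarith)
    have hAD : ∀ d ∈ A, D ≤ d := fun d hd => by
      by_contra! hlt
      exact hlow' d hd.1 hlt hd.2
    have hBA : B ⊆ A := fun d hd => ⟨hd.1, le_antisymm (hd.2 ▸ liminf_le_limsup) zero_le⟩
    have hmem : ∀ d > D, d ∈ B := fun d hd => ⟨hD0.trans hd.le, (hup' d hd).limsup_eq⟩
    have key : ∀ S : Set ℝ, (∀ d ∈ S, D ≤ d) → (∀ d > D, d ∈ S) → sInf S = D :=
      fun S hS1 hS2 => csInf_eq_of_forall_ge_of_forall_gt_exists_lt ⟨D + 1, hS2 _ (by linarith)⟩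
        hS1 fun w hw => ⟨(D + w) / 2, hS2 _ (by linarith), by linarith⟩
    exact ⟨key A hAD fun d hd => hBA (hmem d hd), key B (fun d hd => hAD d (hBA hd)) hmem⟩

end BoxDim

section Sequence

lemma volume_thickening_range_le {t : ℕ → ℝ} (ht : ∀ n, 0 < t n) (hanti : StrictAnti t)
    {ε : ℝ} (hε : 0 < ε) (n : ℕ) :
    volume (thickening ε (range t)) ≤ ENNReal.ofReal (2 * (t n + (n + 1) * ε)) := by
  have hsub : thickening ε (range t) ⊆
      (⋃ k ∈ Finset.range n, ball (t k) ε) ∪ Ioo (-ε) (t n + ε) := by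
    intro x hx
    obtain ⟨_, ⟨k, rfl⟩, hk⟩ := mem_thickening_iff.1 hx
    rcases lt_or_ge k n with h | h
    · exact Or.inl (mem_biUnion (Finset.mem_coe.2 (Finset.mem_range.2 h)) hk)
    · right
      rw [Real.dist_eq, abs_lt] at hk
      have h1 := ht k
      have h2 := hanti.antitone h
      exact ⟨by linarith, by linarith⟩
  calc volume (thickening ε (range t))
      ≤ volume (⋃ k ∈ Finset.range n, ball (t k) ε) + volume (Ioo (-ε) (t n + ε)) :=
        (measure_mono hsub).trans (measure_union_le _ _)
    _ ≤ (∑ k ∈ Finset.range n, volume (ball (t k) ε)) + volume (Ioo (-ε) (t n + ε)) := by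
        gcongr
        exact measure_biUnion_finset_le _ _
    _ ≤ ENNReal.ofReal (n * (2 * ε)) + ENNReal.ofReal (t n + ε - -ε) := by
        simp only [Real.volume_ball, Real.volume_Ioo, Finset.sum_const, Finset.card_range,
          nsmul_eq_mul]
        rw [ENNReal.ofReal_mul (Nat.cast_nonneg n), ENNReal.ofReal_natCast]
    _ ≤ _ := by
        have := ht n
        rw [← ENNReal.ofReal_add (by positivity) (by linarith)]
        exact ENNReal.ofReal_le_ofReal (by linarith)

lemma rpow_tangent_le {m x t : ℝ} (hm : 1 ≤ m) (hx : 0 < x) (hxt : x ≤ t) :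
    m * x ^ (m - 1) * (t - x) ≤ t ^ m - x ^ m := by
  have h := one_add_mul_self_le_rpow_one_add (s := (t - x) / x)
    (by have : 0 ≤ (t - x) / x := div_nonneg (by linarith) hx.le
        linarith) hm
  have h1 : 1 + (t - x) / x = t / x := by field_simp; ring
  rw [h1, Real.div_rpow (by linarith) hx.le, le_div_iff₀ (Real.rpow_pos_of_pos hx m)] at h
  rw [Real.rpow_sub_one hx.ne']
  have h2 : (1 + m * ((t - x) / x)) * x ^ m = x ^ m + m * (x ^ m / x) * (t - x) := by
    field_simp
  linarith

lemma rpow_le_tangent {m x t : ℝ} (hm : 1 ≤ m) (hx : 0 < x) (hxt : x ≤ t) :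
    t ^ m - x ^ m ≤ m * t ^ (m - 1) * (t - x) := by
  have ht : 0 < t := hx.trans_le hxt
  have h1 : 1 + (x - t) / t = x / t := by field_simp; ring
  have h := one_add_mul_self_le_rpow_one_add (s := (x - t) / t)
    (by have : 0 ≤ x / t := div_nonneg hx.le ht.le
        linarith) hm
  rw [h1, Real.div_rpow hx.le ht.le, le_div_iff₀ (Real.rpow_pos_of_pos ht m)] at h
  rw [Real.rpow_sub_one ht.ne']
  have h2 : (1 + m * ((x - t) / t)) * t ^ m = t ^ m - m * (t ^ m / t) * (t - x) := by
    field_simp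
    ring
  linarith

/-- If the gaps of `t ^ m` are decreasing and the gap of `t` at index `k` is small, then the whole
interval `(t k / 2, t k]` is close to the range of `t`. -/
lemma Ioc_subset_thickening_range {m : ℝ} (hm : 1 ≤ m) {t : ℕ → ℝ} (ht : ∀ n, 0 < t n)
    (hanti : StrictAnti t) (hlim : Tendsto t atTop (nhds 0)) {k : ℕ}
    (hgap : ∀ n ≥ k, t (n + 1) ^ m - t (n + 2) ^ m ≤ t n ^ m - t (n + 1) ^ m) {ε : ℝ}
    (hε : 2 ^ (m - 1) * (t k - t (k + 1)) < ε) :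
    Ioc (t k / 2) (t k) ⊆ thickening ε (range t) := by
  have hmono : ∀ j ≥ k, t j ^ m - t (j + 1) ^ m ≤ t k ^ m - t (k + 1) ^ m := by
    intro j hj
    induction j, hj using Nat.le_induction with
    | base => exact le_rfl
    | succ j hj ih => exact (hgap j hj).trans ih
  rintro x ⟨hx1, hx2⟩
  have htk := ht k
  have hx0 : 0 < x := by linarith
  have hex : ∃ i, t i < x := (hlim.eventually_lt_const hx0).exists
  classical
  set i := Nat.find hex with hi
  have hti : t i < x := Nat.find_spec hex
  have hki : k < i := by
    by_contra! h
    have := hanti.antitone h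
    linarith
  obtain ⟨j, hj⟩ : ∃ j, i = j + 1 := Nat.exists_eq_succ_of_ne_zero (by omega)
  have hxj : x ≤ t j := not_lt.1 (Nat.find_min hex (by omega))
  refine mem_thickening_iff.2 ⟨t j, mem_range_self j, ?_⟩
  rw [dist_comm, Real.dist_eq, abs_of_nonneg (by linarith)]
  refine lt_of_le_of_lt ?_ hε
  have hstep : t (k + 1) ≤ t k := hanti.antitone (Nat.le_succ k)
  have h1 := rpow_tangent_le hm hx0 hxj
  have h2 := rpow_le_tangent hm (ht (k + 1)) hstep
  have h3 := hmono j (by omega)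
  have h4 : t (j + 1) ^ m ≤ x ^ m :=
    Real.rpow_le_rpow (ht _).le (by rw [← hj]; exact hti.le) (by linarith)
  have h5 : t k ^ (m - 1) ≤ 2 ^ (m - 1) * x ^ (m - 1) := by
    rw [← Real.mul_rpow (by norm_num) hx0.le]
    exact Real.rpow_le_rpow htk.le (by linarith) (by linarith)
  have h6 : m * t k ^ (m - 1) * (t k - t (k + 1)) ≤
      m * (2 ^ (m - 1) * x ^ (m - 1)) * (t k - t (k + 1)) := by
    gcongr
  have hpos : 0 < m * x ^ (m - 1) := mul_pos (by linarith) (Real.rpow_pos_of_pos hx0 _)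
  refine le_of_mul_le_mul_left ?_ hpos
  calc m * x ^ (m - 1) * (t j - x) ≤ m * (2 ^ (m - 1) * x ^ (m - 1)) * (t k - t (k + 1)) := by
        linarith
    _ = _ := by ring

lemma volume_thickening_range_ge_of_gaps {t : ℕ → ℝ} (hanti : StrictAnti t) {a k : ℕ}
    (hak : a ≤ k) {η ε : ℝ} (hηε : η ≤ ε)
    (hgap : ∀ j, a ≤ j → j < k → η ≤ t j - t (j + 1)) :
    ENNReal.ofReal ((k - a) * η) ≤ volume (thickening ε (range t)) := by
  have hsub : (⋃ j ∈ Finset.Ico a k, Ioc (t j - η) (t j)) ⊆ thickening ε (range t) := by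
    simp only [iUnion_subset_iff]
    rintro j - x ⟨hx1, hx2⟩
    refine mem_thickening_iff.2 ⟨t j, mem_range_self j, ?_⟩
    rw [dist_comm, Real.dist_eq, abs_of_nonneg (by linarith)]
    linarith
  refine le_trans (le_of_eq ?_) (measure_mono hsub)
  rw [measure_biUnion_finset]
  · simp only [Real.volume_Ioc, sub_sub_cancel, Finset.sum_const, Nat.card_Ico, nsmul_eq_mul]
    rw [← Nat.cast_sub hak, ENNReal.ofReal_mul (Nat.cast_nonneg _), ENNReal.ofReal_natCast]
  · have key : ∀ i j, a ≤ i → i < j → j < k →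
        Disjoint (Ioc (t i - η) (t i)) (Ioc (t j - η) (t j)) := by
      intro i j hai hij hjk
      refine Set.disjoint_left.2 fun x hx hx' => ?_
      have h1 := hgap i hai (hij.trans hjk)
      have h2 : t j ≤ t (i + 1) := hanti.antitone hij
      have := hx.1
      have := hx'.2
      linarith
    intro i hi j hj hij
    simp only [Finset.coe_Ico, Set.mem_Ico] at hi hj
    rcases lt_or_gt_of_ne hij with h | h
    · exact key i j hi.1 h hj.2
    · exact (key j i hj.1 h hi.2).symm
  · exact fun _ _ => measurableSet_Ioc

lemma exists_le_volume_thickening_range {m : ℝ} (hm : 1 ≤ m) (n₀ : ℕ) :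
    ∃ c > 0, ∀ t : ℕ → ℝ, (∀ n, 0 < t n) → StrictAnti t → Tendsto t atTop (nhds 0) →
      (∀ n ≥ n₀, t (n + 1) ^ m - t (n + 2) ^ m ≤ t n ^ m - t (n + 1) ^ m) →
      ∀ ε > 0, ∃ k : ℕ,
        ENNReal.ofReal (c * (t k + (k + 1) * ε)) ≤ volume (thickening ε (range t)) := by
  set p : ℝ := 2 ^ (m - 1) with hp
  have hp1 : 1 ≤ p := Real.one_le_rpow (by norm_num) (by linarith)
  refine ⟨(p + n₀ + 3)⁻¹, by positivity, fun t ht hanti hlim hgap ε hε => ?_⟩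
  have hex : ∃ k, n₀ ≤ k ∧ p * (t k - t (k + 1)) < ε := by
    have h1 : Tendsto (fun k => p * (t k - t (k + 1))) atTop (nhds 0) := by
      simpa using (hlim.sub (hlim.comp (tendsto_add_atTop_nat 1))).const_mul p
    exact ((eventually_ge_atTop n₀).and (h1.eventually_lt_const hε)).exists
  classical
  set k := Nat.find hex with hk
  obtain ⟨hk0, hkε⟩ : n₀ ≤ k ∧ p * (t k - t (k + 1)) < ε := Nat.find_spec hex
  refine ⟨k, ?_⟩
  set V := volume (thickening ε (range t)) with hV
  have h1 : ENNReal.ofReal (t k / 2) ≤ V := by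
    have := measure_mono (μ := volume) (Ioc_subset_thickening_range hm ht hanti hlim
      (fun n hn => hgap n (hk0.trans hn)) hkε)
    rw [Real.volume_Ioc] at this
    convert this using 2
    ring
  have h2 : ENNReal.ofReal ((k - n₀) * (ε / p)) ≤ V := by
    refine volume_thickening_range_ge_of_gaps hanti hk0
      (div_le_self hε.le hp1) fun j hj hjk => ?_
    have := Nat.find_min hex hjk
    simp only [not_and, not_lt] at this
    rw [div_le_iff₀' (by positivity)]
    exact this hj
  have h3 : ENNReal.ofReal ε ≤ V := by
    have : ball (t 0) ε ⊆ thickening ε (range t) := ball_subset_thickening (mem_range_self 0) ε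
    refine le_trans ?_ (measure_mono this)
    rw [Real.volume_ball]
    exact ENNReal.ofReal_le_ofReal (by linarith)
  rcases eq_or_ne V ⊤ with htop | htop
  · rw [htop]
    exact le_top
  rw [ENNReal.ofReal_le_iff_le_toReal htop] at h1 h2 h3 ⊢
  rw [inv_mul_le_iff₀ (by positivity)]
  have h4 : ((k : ℝ) - n₀) * ε ≤ p * V.toReal := by
    calc ((k : ℝ) - n₀) * ε = p * ((k - n₀) * (ε / p)) := by field_simp
      _ ≤ _ := mul_le_mul_of_nonneg_left h2 (by linarith)
  have h5 : ((n₀ : ℝ) + 1) * ε ≤ (n₀ + 1) * V.toReal :=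
    mul_le_mul_of_nonneg_left h3 (by positivity)
  calc t k + (k + 1) * ε = t k + (k - n₀) * ε + (n₀ + 1) * ε := by ring
    _ ≤ (p + n₀ + 3) * V.toReal := by linarith

end Sequence

section SequenceDim

/-- A positive sequence decreasing to `0` whose `m`-th power has eventually decreasing gaps. -/
structure IsGapSeq (m : ℝ) (t : ℕ → ℝ) : Prop where
  pos : ∀ n, 0 < t n
  anti : StrictAnti t
  lim : Tendsto t atTop (nhds 0)
  gap : ∃ n₀ : ℕ, ∀ n ≥ n₀, t (n + 1) ^ m - t (n + 2) ^ m ≤ t n ^ m - t (n + 1) ^ m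

/-- Upper power bound for `inf_n (t n + (n + 1) ε)`. -/
def IsUpperExponent (t : ℕ → ℝ) (δ : ℝ) : Prop :=
  ∃ C : ℝ, ∀ ε ∈ Ioc (0 : ℝ) 1, ∃ n : ℕ, t n + (n + 1) * ε ≤ C * ε ^ (1 - δ)

/-- Lower power bound for `inf_n (t n + (n + 1) ε)`. -/
def IsLowerExponent (t : ℕ → ℝ) (δ : ℝ) : Prop :=
  ∃ c > 0, ∀ ε ∈ Ioc (0 : ℝ) 1, ∀ n : ℕ, c * ε ^ (1 - δ) ≤ t n + (n + 1) * ε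

variable {m : ℝ} {t : ℕ → ℝ} {δ : ℝ}

lemma IsGapSeq.hasUpperContent_iff (hm : 1 ≤ m) (h : IsGapSeq m t) :
    HasUpperContent 1 (range t) δ ↔ IsUpperExponent t δ := by
  constructor
  · rintro ⟨C, hC⟩
    obtain ⟨n₀, hgap⟩ := h.gap
    obtain ⟨c, hc, H⟩ := exists_le_volume_thickening_range hm n₀
    refine ⟨c⁻¹ * C, fun ε hε => ?_⟩
    obtain ⟨k, hk⟩ := H t h.pos h.anti h.lim hgap ε hε.1
    refine ⟨k, ?_⟩
    have hk0 := h.pos k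
    have hε0 := hε.1
    have h1 := (ENNReal.ofReal_le_ofReal_iff'.1 (hk.trans (hC ε hε))).resolve_right
      (not_le.2 (by positivity))
    rw [mul_assoc, le_inv_mul_iff₀ hc]
    exact h1
  · rintro ⟨C, hC⟩
    refine ⟨2 * C, fun ε hε => ?_⟩
    obtain ⟨n, hn⟩ := hC ε hε
    exact (volume_thickening_range_le h.pos h.anti hε.1 n).trans
      (ENNReal.ofReal_le_ofReal (by linarith))

lemma IsGapSeq.hasLowerContent_iff (hm : 1 ≤ m) (h : IsGapSeq m t) :
    HasLowerContent 1 (range t) δ ↔ IsLowerExponent t δ := by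
  constructor
  · rintro ⟨c, hc, hC⟩
    refine ⟨c / 2, by positivity, fun ε hε n => ?_⟩
    have hp : 0 < ε ^ (1 - δ) := Real.rpow_pos_of_pos hε.1 _
    have h1 := (ENNReal.ofReal_le_ofReal_iff'.1 ((hC ε hε).trans
      (volume_thickening_range_le h.pos h.anti hε.1 n))).resolve_right
      (not_le.2 (by positivity))
    linarith
  · rintro ⟨c, hc, hC⟩
    obtain ⟨n₀, hgap⟩ := h.gap
    obtain ⟨c', hc', H⟩ := exists_le_volume_thickening_range hm n₀
    refine ⟨c' * c, by positivity, fun ε hε => ?_⟩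
    obtain ⟨k, hk⟩ := H t h.pos h.anti h.lim hgap ε hε.1
    refine le_trans (ENNReal.ofReal_le_ofReal ?_) hk
    rw [mul_assoc]
    exact mul_le_mul_of_nonneg_left (hC ε hε k) hc'.le

lemma IsGapSeq.hasBoxDim_iff (hm : 1 ≤ m) (h : IsGapSeq m t) {D : ℝ} :
    HasBoxDim 1 (range t) D ↔ D ∈ Icc 0 1 ∧
      (∀ δ ∈ Ioo D 1, IsUpperExponent t δ) ∧ ∀ δ ∈ Ioo 0 D, IsLowerExponent t δ := by
  rw [_root_.hasBoxDim_iff zero_le_one]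
  · simp only [h.hasUpperContent_iff hm, h.hasLowerContent_iff hm]
  · exact ne_top_of_le_ne_top ENNReal.ofReal_ne_top
      (volume_thickening_range_le h.pos h.anti one_pos 0)
  · exact fun ε hε => isOpen_thickening.measure_pos volume
      ⟨t 0, self_subset_thickening hε _ (mem_range_self 0)⟩

lemma div_succ_rpow {q : ℝ} (hq : 0 < q) (n : ℕ) (a : ℝ) :
    (q / ((n : ℝ) + 1)) ^ a = q ^ a * ((n : ℝ) + 1) ^ (-a) := by
  rw [Real.div_rpow hq.le (by positivity), Real.rpow_neg (by positivity), div_eq_mul_inv]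

lemma isUpperExponent_iff (hpos : ∀ n, 0 < t n) (hanti : Antitone t) (hδ : δ ∈ Ioo 0 1) :
    IsUpperExponent t δ ↔ ∃ C, ∀ n : ℕ, t n ≤ C * ((n : ℝ) + 1) ^ (-((1 - δ) / δ)) := by
  have hδ0 := hδ.1
  have hδ1 : 0 < 1 - δ := by linarith [hδ.2]
  constructor
  · rintro ⟨C, hC⟩
    have hC0 : 0 < C := by
      obtain ⟨n, hn⟩ := hC 1 ⟨one_pos, le_rfl⟩
      have := hpos n
      rw [Real.one_rpow, mul_one, mul_one] at hn
      have : (0 : ℝ) ≤ n := Nat.cast_nonneg n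
      linarith
    refine ⟨(t 0 + C) * C ^ ((1 - δ) / δ), fun n => ?_⟩
    rw [mul_assoc, ← div_succ_rpow hC0]
    have h0 := hpos 0
    rcases le_or_gt ((n : ℝ) + 1) C with h | h
    · have h1 : 1 ≤ (C / ((n : ℝ) + 1)) ^ ((1 - δ) / δ) :=
        Real.one_le_rpow ((one_le_div (by positivity)).2 h) (by positivity)
      calc t n ≤ t 0 := hanti (Nat.zero_le n)
        _ ≤ (t 0 + C) * 1 := by linarith
        _ ≤ _ := by gcongr
    · set ε := (C / ((n : ℝ) + 1)) ^ (1 / δ) with hε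
      have hq : 0 < C / ((n : ℝ) + 1) := by positivity
      have hε0 : 0 < ε := Real.rpow_pos_of_pos hq _
      have hε1 : ε ≤ 1 := Real.rpow_le_one hq.le
        ((div_le_one (by positivity)).2 h.le) (by positivity)
      have hεδ : ε ^ δ = C / ((n : ℝ) + 1) := by
        rw [hε, ← Real.rpow_mul hq.le, one_div_mul_cancel hδ0.ne', Real.rpow_one]
      have hεa : ε ^ (1 - δ) = (C / ((n : ℝ) + 1)) ^ ((1 - δ) / δ) := by
        rw [hε, ← Real.rpow_mul hq.le]
        congr 1
        ring
      obtain ⟨k, hk⟩ := hC ε ⟨hε0, hε1⟩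
      have hk0 := hpos k
      have hkn : k ≤ n := by
        have h1 : ((k : ℝ) + 1) * ε ≤ C * ε ^ (1 - δ) := by linarith
        have h2 : ε = ε ^ δ * ε ^ (1 - δ) := by
          rw [← Real.rpow_add hε0, add_sub_cancel, Real.rpow_one]
        have h3 : ((k : ℝ) + 1) * ε ^ δ ≤ C := by
          refine le_of_mul_le_mul_right ?_ (Real.rpow_pos_of_pos hε0 (1 - δ))
          rw [mul_assoc, ← h2]
          exact h1
        rw [hεδ, ← mul_div_assoc, div_le_iff₀ (by positivity), mul_comm] at h3
        have h4 := le_of_mul_le_mul_left h3 hC0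
        exact_mod_cast (add_le_add_iff_right 1).1 h4
      rw [← hεa]
      have h5 : 0 < ((k : ℝ) + 1) * ε := by positivity
      have h6 : 0 ≤ t 0 * ε ^ (1 - δ) := by positivity
      have h7 := hanti hkn
      linarith
  · rintro ⟨C, hC⟩
    have hC0 : 0 < C := by
      have := hC 0
      simp only [Nat.cast_zero, zero_add, Real.one_rpow, mul_one] at this
      exact (hpos 0).trans_le this
    refine ⟨C + 2, fun ε hε => ?_⟩
    have hε0 := hε.1
    have hp : 0 < ε ^ (-δ) := Real.rpow_pos_of_pos hε0 _
    refine ⟨⌊ε ^ (-δ)⌋₊, ?_⟩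
    set n := ⌊ε ^ (-δ)⌋₊ with hn
    have h1 : (n : ℝ) ≤ ε ^ (-δ) := Nat.floor_le hp.le
    have h2 : ε ^ (-δ) < n + 1 := Nat.lt_floor_add_one _
    have h3 : 1 ≤ ε ^ (-δ) := Real.one_le_rpow_of_pos_of_le_one_of_nonpos hε0 hε.2 (by linarith)
    have h4 : ((n : ℝ) + 1) ^ (-((1 - δ) / δ)) ≤ ε ^ (1 - δ) := by
      calc ((n : ℝ) + 1) ^ (-((1 - δ) / δ)) ≤ (ε ^ (-δ)) ^ (-((1 - δ) / δ)) :=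
            Real.rpow_le_rpow_of_nonpos hp h2.le (by rw [neg_nonpos]; positivity)
        _ = ε ^ (1 - δ) := by
            rw [← Real.rpow_mul hε0.le]
            congr 1
            field_simp
    have h5 : ε ^ (-δ) * ε = ε ^ (1 - δ) := by
      rw [← Real.rpow_add_one hε0.ne']
      congr 1
      ring
    calc t n + (n + 1) * ε ≤ C * ε ^ (1 - δ) + (ε ^ (-δ) + ε ^ (-δ)) * ε := by
          gcongr
          exact (hC n).trans (by gcongr)
      _ = (C + 2) * ε ^ (1 - δ) := by rw [add_mul, h5]; ring

lemma isLowerExponent_iff (hpos : ∀ n, 0 < t n) (hδ : δ ∈ Ioo 0 1) :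
    IsLowerExponent t δ ↔ ∃ c > 0, ∀ n : ℕ, c * ((n : ℝ) + 1) ^ (-((1 - δ) / δ)) ≤ t n := by
  have hδ0 := hδ.1
  have hδ1 : 0 < 1 - δ := by linarith [hδ.2]
  constructor
  · rintro ⟨c, hc, hC⟩
    set q := min (c / 2) 1 with hqdef
    have hq0 : 0 < q := by positivity
    refine ⟨c / 2 * q ^ ((1 - δ) / δ), by positivity, fun n => ?_⟩
    rw [mul_assoc, ← div_succ_rpow hq0]
    set ε := (q / ((n : ℝ) + 1)) ^ (1 / δ) with hε
    have hq : 0 < q / ((n : ℝ) + 1) := by positivity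
    have hε0 : 0 < ε := Real.rpow_pos_of_pos hq _
    have hn : (1 : ℝ) ≤ n + 1 := by linarith [(Nat.cast_nonneg n : (0 : ℝ) ≤ n)]
    have hε1 : ε ≤ 1 := Real.rpow_le_one hq.le
      ((div_le_one (by positivity)).2 ((min_le_right _ _).trans hn)) (by positivity)
    have hεδ : ε ^ δ = q / ((n : ℝ) + 1) := by
      rw [hε, ← Real.rpow_mul hq.le, one_div_mul_cancel hδ0.ne', Real.rpow_one]
    have hεa : ε ^ (1 - δ) = (q / ((n : ℝ) + 1)) ^ ((1 - δ) / δ) := by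
      rw [hε, ← Real.rpow_mul hq.le]
      congr 1
      ring
    rw [← hεa]
    have h1 := hC ε ⟨hε0, hε1⟩ n
    have h2 : ((n : ℝ) + 1) * ε = q * ε ^ (1 - δ) := by
      have : ε = ε ^ δ * ε ^ (1 - δ) := by
        rw [← Real.rpow_add hε0, add_sub_cancel, Real.rpow_one]
      conv_lhs => rw [this, hεδ]
      field_simp
    have h3 : q * ε ^ (1 - δ) ≤ c / 2 * ε ^ (1 - δ) := by
      gcongr
      exact min_le_left _ _
    linarith
  · rintro ⟨c, hc, hC⟩
    refine ⟨min c 1, by positivity, fun ε hε n => ?_⟩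
    have hε0 := hε.1
    have hp : 0 < ε ^ (-δ) := Real.rpow_pos_of_pos hε0 _
    have hn0 := hpos n
    rcases le_or_gt ((n : ℝ) + 1) (ε ^ (-δ)) with h | h
    · have h4 : ε ^ (1 - δ) ≤ ((n : ℝ) + 1) ^ (-((1 - δ) / δ)) := by
        calc ε ^ (1 - δ) = (ε ^ (-δ)) ^ (-((1 - δ) / δ)) := by
              rw [← Real.rpow_mul hε0.le]
              congr 1
              field_simp
          _ ≤ _ := Real.rpow_le_rpow_of_nonpos (by positivity) h
              (by rw [neg_nonpos]; positivity)
      calc min c 1 * ε ^ (1 - δ) ≤ c * ((n : ℝ) + 1) ^ (-((1 - δ) / δ)) := by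
            gcongr
            exact min_le_left _ _
        _ ≤ t n := hC n
        _ ≤ _ := by
            have : 0 < ((n : ℝ) + 1) * ε := by positivity
            linarith
    · have h5 : ε ^ (-δ) * ε = ε ^ (1 - δ) := by
        rw [← Real.rpow_add_one hε0.ne']
        congr 1
        ring
      calc min c 1 * ε ^ (1 - δ) ≤ 1 * ε ^ (1 - δ) := by
            gcongr
            exact min_le_right _ _
        _ = ε ^ (-δ) * ε := by rw [h5, one_mul]
        _ ≤ (n + 1) * ε := by gcongr
        _ ≤ _ := by linarith

lemma IsGapSeq.rpow_inv (hm : 1 ≤ m) (h : IsGapSeq 1 t) :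
    IsGapSeq m fun n => t n ^ (1 / m) where
  pos n := Real.rpow_pos_of_pos (h.pos n) _
  anti _ _ hab := Real.rpow_lt_rpow (h.pos _).le (h.anti hab) (by positivity)
  lim := by
    have h1 := h.lim.rpow_const (p := 1 / m) (Or.inr (by positivity))
    rwa [Real.zero_rpow (by positivity)] at h1
  gap := by
    obtain ⟨n₀, hn⟩ := h.gap
    refine ⟨n₀, fun n hn' => ?_⟩
    have key : ∀ k, (t k ^ (1 / m)) ^ m = t k := fun k => by
      rw [← Real.rpow_mul (h.pos k).le, one_div_mul_cancel (by positivity), Real.rpow_one]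
    simpa only [key, Real.rpow_one] using hn n hn'

lemma IsGapSeq.hasBoxDim_rpow_inv (hm : 1 ≤ m) (h : IsGapSeq 1 t) {D : ℝ}
    (hD : HasBoxDim 1 (range t) D) :
    HasBoxDim 1 (range fun n => t n ^ (1 / m)) (m * D / (m * D + 1 - D)) := by
  have h' := h.rpow_inv hm
  rw [h.hasBoxDim_iff le_rfl] at hD
  rw [h'.hasBoxDim_iff hm]
  obtain ⟨⟨hD0, hD1⟩, hup, hlow⟩ := hD
  have hden : 0 < m * D + 1 - D := by nlinarith
  have hm0 : 0 < m := by linarith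
  have hsub : ∀ δ ∈ Ioo (0 : ℝ) 1, δ / (δ + m * (1 - δ)) ∈ Ioo (0 : ℝ) 1 ∧
      (1 - δ / (δ + m * (1 - δ))) / (δ / (δ + m * (1 - δ))) * (1 / m) = (1 - δ) / δ := by
    rintro δ ⟨h0, h1⟩
    have h2 : 0 < 1 - δ := by linarith
    have h3 : 0 < m * (1 - δ) := by positivity
    refine ⟨⟨by positivity, (div_lt_one (by positivity)).2 (by linarith)⟩, ?_⟩
    field_simp
    ring
  refine ⟨⟨by positivity, (div_le_one hden).2 (by linarith)⟩, fun δ hδ => ?_, fun δ hδ => ?_⟩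
  · have hδ1 := hδ.2
    have hδ0 : 0 < δ := lt_of_le_of_lt (by positivity) hδ.1
    have hlt := (div_lt_iff₀ hden).1 hδ.1
    obtain ⟨hmem, heq⟩ := hsub δ ⟨hδ0, hδ1⟩
    have h3 : 0 < m * (1 - δ) := mul_pos hm0 (by linarith)
    have hDδ : D < δ / (δ + m * (1 - δ)) := by
      rw [lt_div_iff₀ (by positivity)]
      nlinarith
    obtain ⟨C, hC⟩ := (isUpperExponent_iff h.pos h.anti.antitone hmem).1 (hup _ ⟨hDδ, hmem.2⟩)
    refine (isUpperExponent_iff h'.pos h'.anti.antitone ⟨hδ0, hδ1⟩).2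
      ⟨C ^ (1 / m), fun n => ?_⟩
    have hC0 : 0 ≤ C := by
      have := (h.pos 0).trans_le (hC 0)
      simp only [Nat.cast_zero, zero_add, Real.one_rpow, mul_one] at this
      exact this.le
    rw [← heq, ← neg_mul, Real.rpow_mul (by positivity), ← Real.mul_rpow hC0 (by positivity)]
    exact Real.rpow_le_rpow (h.pos n).le (hC n) (by positivity)
  · have hδ0 := hδ.1
    have hlt := (lt_div_iff₀ hden).1 hδ.2
    have hδ1 : δ < 1 := lt_of_lt_of_le hδ.2 ((div_le_one hden).2 (by linarith))
    obtain ⟨hmem, heq⟩ := hsub δ ⟨hδ0, hδ1⟩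
    have h3 : 0 < m * (1 - δ) := mul_pos hm0 (by linarith)
    have hDδ : δ / (δ + m * (1 - δ)) < D := by
      rw [div_lt_iff₀ (by positivity)]
      nlinarith
    obtain ⟨c, hc, hC⟩ := (isLowerExponent_iff h.pos hmem).1 (hlow _ ⟨hmem.1, hDδ⟩)
    refine (isLowerExponent_iff h'.pos ⟨hδ0, hδ1⟩).2
      ⟨c ^ (1 / m), Real.rpow_pos_of_pos hc _, fun n => ?_⟩
    rw [← heq, ← neg_mul, Real.rpow_mul (by positivity), ← Real.mul_rpow hc.le (by positivity)]
    exact Real.rpow_le_rpow (by positivity) (hC n) (by positivity)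

end SequenceDim

section Plane

/-- A subset of the unit square without two strictly increasing points has a neighborhood of
volume of order `ε`. -/
lemma volume_thickening_antichain_le {Γ : Set (ℝ × ℝ)} (hΓ : Γ ⊆ Icc 0 1 ×ˢ Icc 0 1)
    (hanti : ∀ p ∈ Γ, ∀ q ∈ Γ, p.1 < q.1 → q.2 ≤ p.2) {ε : ℝ} (hε : ε ∈ Ioc (0 : ℝ) 1) :
    volume (thickening ε Γ) ≤ ENNReal.ofReal (12 * ε) := by
  have hnear : ∀ p ∈ thickening ε Γ, ∃ q ∈ Γ, |p.1 - q.1| < ε ∧ |p.2 - q.2| < ε := by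
    intro p hp
    obtain ⟨q, hq, hd⟩ := mem_thickening_iff.1 hp
    rw [Prod.dist_eq, max_lt_iff, Real.dist_eq, Real.dist_eq] at hd
    exact ⟨q, hq, hd⟩
  have hmeas : MeasurableSet (thickening ε Γ) := isOpen_thickening.measurableSet
  have hmp : MeasurePreserving (fun z : ℝ × ℝ => (z.1, z.1 + z.2)) volume volume :=
    measurePreserving_prod_add volume volume
  rw [← hmp.measure_preimage hmeas.nullMeasurableSet, Measure.volume_eq_prod,
    Measure.prod_apply_symm (hmp.measurable hmeas)]
  have hslice : ∀ y, volume ((fun x => (x, y)) ⁻¹'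
      ((fun z : ℝ × ℝ => (z.1, z.1 + z.2)) ⁻¹' thickening ε Γ)) ≤
      (Icc (-3) 3).indicator (fun _ => ENNReal.ofReal (2 * ε)) y := by
    intro y
    by_cases hy : y ∈ Icc (-3 : ℝ) 3
    · rw [indicator_of_mem hy]
      refine (Real.volume_le_diam _).trans (Metric.ediam_le ?_)
      have key : ∀ a b : ℝ, (a, a + y) ∈ thickening ε Γ → (b, b + y) ∈ thickening ε Γ →
          b - a ≤ 2 * ε := by
        intro a b ha hb
        obtain ⟨p, hp, hp1, hp2⟩ := hnear _ ha
        obtain ⟨q, hq, hq1, hq2⟩ := hnear _ hb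
        rw [abs_lt] at hp1 hp2 hq1 hq2
        simp only at hp1 hp2 hq1 hq2
        by_contra! hlt
        have := hanti p hp q hq (by linarith)
        linarith
      intro a ha b hb
      rw [edist_dist, Real.dist_eq]
      refine ENNReal.ofReal_le_ofReal (abs_le.2 ⟨?_, ?_⟩)
      · linarith [key a b ha hb]
      · linarith [key b a hb ha]
    · rw [indicator_of_notMem hy, nonpos_iff_eq_zero]
      convert measure_empty (μ := volume)
      refine eq_empty_of_forall_notMem fun x hx => hy ?_
      obtain ⟨q, hq, hq1, hq2⟩ := hnear _ hx
      obtain ⟨⟨h1, h2⟩, h3, h4⟩ := hΓ hq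
      rw [abs_lt] at hq1 hq2
      simp only at hq1 hq2
      have := hε.2
      exact ⟨by linarith, by linarith⟩
  refine (lintegral_mono hslice).trans (le_of_eq ?_)
  rw [lintegral_indicator_const measurableSet_Icc, Real.volume_Icc,
    ← ENNReal.ofReal_mul (by linarith [hε.1])]
  congr 1
  ring

/-- The part of the unit square on which `x ^ r * y` is at most `s`. -/
def hyperbolaSublevel (r s : ℝ) : Set (ℝ × ℝ) :=
  {p | p.1 ∈ Ioc (0 : ℝ) 1 ∧ p.2 ∈ Ioc (0 : ℝ) 1 ∧ p.1 ^ r * p.2 ≤ s}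

lemma volume_hyperbolaSublevel_le {r s θ : ℝ} (hs : 0 < s) (hθ : θ ∈ Ioc 0 1)
    (hrθ : r * θ < 1) :
    volume (hyperbolaSublevel r s) ≤ ENNReal.ofReal (s ^ θ / (1 - r * θ)) := by
  have hmeas : MeasurableSet (hyperbolaSublevel r s) := by
    have h1 : Measurable fun p : ℝ × ℝ => p.1 ^ r * p.2 :=
      (measurable_fst.pow_const r).mul measurable_snd
    exact (measurable_fst measurableSet_Ioc).inter
      ((measurable_snd measurableSet_Ioc).inter (measurableSet_le h1 measurable_const))
  rw [Measure.volume_eq_prod, Measure.prod_apply hmeas]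
  have hslice : ∀ x, volume (Prod.mk x ⁻¹' hyperbolaSublevel r s) ≤
      (Ioc (0 : ℝ) 1).indicator (fun x => ENNReal.ofReal (s ^ θ * x ^ (-(r * θ)))) x := by
    intro x
    by_cases hx : x ∈ Ioc (0 : ℝ) 1
    · rw [indicator_of_mem hx]
      have hsub : Prod.mk x ⁻¹' hyperbolaSublevel r s ⊆ Icc 0 (s ^ θ * x ^ (-(r * θ))) := by
        rintro y ⟨-, ⟨hy0, hy1⟩, hy⟩
        simp only at hy0 hy1 hy
        refine ⟨hy0.le, ?_⟩
        have hxr : 0 < x ^ r := Real.rpow_pos_of_pos hx.1 r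
        calc y = y ^ (1 : ℝ) := (Real.rpow_one y).symm
          _ ≤ y ^ θ := Real.rpow_le_rpow_of_exponent_ge hy0 hy1 hθ.2
          _ ≤ (s * x ^ (-r)) ^ θ := by
              refine Real.rpow_le_rpow hy0.le ?_ hθ.1.le
              rw [Real.rpow_neg hx.1.le, ← div_eq_mul_inv, le_div_iff₀ hxr, mul_comm]
              exact hy
          _ = _ := by
              rw [Real.mul_rpow hs.le (Real.rpow_nonneg hx.1.le _), ← Real.rpow_mul hx.1.le,
                neg_mul]
      refine (measure_mono hsub).trans (le_of_eq ?_)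
      rw [Real.volume_Icc, sub_zero]
    · rw [indicator_of_notMem hx, nonpos_iff_eq_zero]
      convert measure_empty (μ := volume)
      exact eq_empty_of_forall_notMem fun y hy => hx hy.1
  refine (lintegral_mono hslice).trans (le_of_eq ?_)
  have hint : IntervalIntegrable (fun x : ℝ => s ^ θ * x ^ (-(r * θ))) volume 0 1 :=
    (intervalIntegral.intervalIntegrable_rpow' (by linarith)).const_mul _
  rw [lintegral_indicator measurableSet_Ioc, ← ofReal_integral_eq_lintegral_ofReal
    ((intervalIntegrable_iff_integrableOn_Ioc_of_le zero_le_one).1 hint)]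
  · rw [← intervalIntegral.integral_of_le zero_le_one, intervalIntegral.integral_const_mul,
      integral_rpow (Or.inl (by linarith)), Real.one_rpow, Real.zero_rpow (by linarith), sub_zero,
      mul_one_div, neg_add_eq_sub]
  · filter_upwards [ae_restrict_mem measurableSet_Ioc] with x hx
    exact mul_nonneg (Real.rpow_nonneg hs.le _) (Real.rpow_nonneg hx.1.le _)

lemma volume_thickening_hyperbolaSublevel_le {r s : ℝ} (hr : 0 < r) {ε : ℝ}
    (hε : ε ∈ Ioc (0 : ℝ) 1) :
    volume (thickening ε (hyperbolaSublevel r s)) ≤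
      ENNReal.ofReal (12 * ε) + volume (hyperbolaSublevel r s) := by
  have hε0 := hε.1
  have hε1 := hε.2
  have hsub : thickening ε (hyperbolaSublevel r s) ⊆
      (Icc (-ε) ε ×ˢ Icc (-1) 2 ∪ Icc (-1) 2 ×ˢ Icc (-ε) ε) ∪
        (fun p => p + (-ε, -ε)) ⁻¹' hyperbolaSublevel r s := by
    rintro ⟨x, y⟩ hp
    obtain ⟨⟨a, b⟩, ⟨⟨ha0, ha1⟩, ⟨hb0, hb1⟩, hab⟩, hd⟩ := mem_thickening_iff.1 hp
    rw [Prod.dist_eq, max_lt_iff, Real.dist_eq, Real.dist_eq, abs_lt, abs_lt] at hd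
    simp only at ha0 ha1 hb0 hb1 hab hd
    obtain ⟨⟨h1, h2⟩, h3, h4⟩ := hd
    rcases le_or_gt x ε with hx | hx
    · exact Or.inl (Or.inl ⟨⟨by linarith, hx⟩, ⟨by linarith, by linarith⟩⟩)
    rcases le_or_gt y ε with hy | hy
    · exact Or.inl (Or.inr ⟨⟨by linarith, by linarith⟩, ⟨by linarith, hy⟩⟩)
    right
    refine ⟨⟨?_, ?_⟩, ⟨?_, ?_⟩, le_trans ?_ hab⟩ <;> simp only [Prod.mk_add_mk]
    any_goals linarith
    have h5 : x + -ε ≤ a := by linarith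
    have h6 : y + -ε ≤ b := by linarith
    have h7 : 0 < x + -ε := by linarith
    have h8 : 0 < y + -ε := by linarith
    gcongr
  have h1 : volume (Icc (-ε) ε ×ˢ Icc (-1 : ℝ) 2) = ENNReal.ofReal (6 * ε) := by
    rw [Measure.volume_eq_prod, Measure.prod_prod, Real.volume_Icc, Real.volume_Icc,
      ← ENNReal.ofReal_mul (by linarith)]
    congr 1
    ring
  have h2 : volume (Icc (-1 : ℝ) 2 ×ˢ Icc (-ε) ε) = ENNReal.ofReal (6 * ε) := by
    rw [Measure.volume_eq_prod, Measure.prod_prod, Real.volume_Icc, Real.volume_Icc,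
      ← ENNReal.ofReal_mul (by linarith)]
    congr 1
    ring
  calc volume (thickening ε (hyperbolaSublevel r s))
      ≤ volume (Icc (-ε) ε ×ˢ Icc (-1 : ℝ) 2) + volume (Icc (-1 : ℝ) 2 ×ˢ Icc (-ε) ε) +
        volume ((fun p => p + (-ε, -ε)) ⁻¹' hyperbolaSublevel r s) :=
        (measure_mono hsub).trans ((measure_union_le _ _).trans
          (add_le_add_left (measure_union_le _ _) _))
    _ = _ := by
        rw [measure_preimage_add_right, h1, h2, ← ENNReal.ofReal_add (by linarith) (by linarith)]
        congr 2
        ring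

/-- The family of hyperbolas `x ^ r * y ∈ S` in the unit square, with `S` the range of `s`. -/
def hyperbolaFamily (r : ℝ) (s : ℕ → ℝ) : Set (ℝ × ℝ) :=
  {p | p.1 ∈ Ioc (0 : ℝ) 1 ∧ p.2 ∈ Ioc (0 : ℝ) 1 ∧ p.1 ^ r * p.2 ∈ range s}

lemma volume_thickening_hyperbolaFamily_le {r θ : ℝ} (hr : 0 < r) {s : ℕ → ℝ}
    (hs : ∀ n, 0 < s n) (hanti : Antitone s) (hθ : θ ∈ Ioc 0 1) (hrθ : r * θ < 1) {ε : ℝ}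
    (hε : ε ∈ Ioc (0 : ℝ) 1) (n : ℕ) :
    volume (thickening ε (hyperbolaFamily r s)) ≤
      ENNReal.ofReal (s n ^ θ / (1 - r * θ) + 12 * ((n + 1) * ε)) := by
  set Γ : ℕ → Set (ℝ × ℝ) := fun k =>
    {p | p.1 ∈ Ioc (0 : ℝ) 1 ∧ p.2 ∈ Ioc (0 : ℝ) 1 ∧ p.1 ^ r * p.2 = s k} with hΓ
  have hε0 := hε.1
  have hsub : hyperbolaFamily r s ⊆
      (⋃ k ∈ Finset.range n, Γ k) ∪ hyperbolaSublevel r (s n) := by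
    rintro p ⟨hp1, hp2, k, hk⟩
    rcases lt_or_ge k n with h | h
    · exact Or.inl (mem_biUnion (Finset.mem_coe.2 (Finset.mem_range.2 h)) ⟨hp1, hp2, hk.symm⟩)
    · exact Or.inr ⟨hp1, hp2, hk ▸ hanti h⟩
  have hcurve : ∀ k, volume (thickening ε (Γ k)) ≤ ENNReal.ofReal (12 * ε) := by
    intro k
    refine volume_thickening_antichain_le ?_ ?_ hε
    · rintro p ⟨hp1, hp2, -⟩
      exact ⟨⟨hp1.1.le, hp1.2⟩, ⟨hp2.1.le, hp2.2⟩⟩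
    · rintro p ⟨hp1, hp2, hp⟩ q ⟨hq1, hq2, hq⟩ hpq
      have h0 : 0 < p.1 ^ r := Real.rpow_pos_of_pos hp1.1 r
      refine le_of_mul_le_mul_left ?_ h0
      rw [hp, ← hq]
      exact mul_le_mul_of_nonneg_right (Real.rpow_le_rpow hp1.1.le hpq.le hr.le) hq2.1.le
  have hunion : thickening ε (hyperbolaFamily r s) ⊆
      (⋃ k ∈ Finset.range n, thickening ε (Γ k)) ∪
        thickening ε (hyperbolaSublevel r (s n)) := by
    refine (thickening_subset_of_subset ε hsub).trans ?_
    simp only [thickening_union, thickening_iUnion, subset_rfl]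
  have hden : 0 < 1 - r * θ := by linarith
  calc volume (thickening ε (hyperbolaFamily r s))
      ≤ (∑ k ∈ Finset.range n, volume (thickening ε (Γ k))) +
        volume (thickening ε (hyperbolaSublevel r (s n))) :=
        (measure_mono hunion).trans ((measure_union_le _ _).trans
          (add_le_add_left (measure_biUnion_finset_le _ _) _))
    _ ≤ (∑ k ∈ Finset.range n, ENNReal.ofReal (12 * ε)) +
        (ENNReal.ofReal (12 * ε) + ENNReal.ofReal (s n ^ θ / (1 - r * θ))) := by
        gcongr with k
        · exact hcurve k
        · exact (volume_thickening_hyperbolaSublevel_le hr hε).trans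
            (add_le_add_right (volume_hyperbolaSublevel_le (hs n) hθ hrθ) _)
    _ = _ := by
        have h1 : 0 ≤ s n ^ θ / (1 - r * θ) := div_nonneg (Real.rpow_nonneg (hs n).le _) hden.le
        rw [Finset.sum_const, Finset.card_range, nsmul_eq_mul, ← ENNReal.ofReal_natCast,
          ← ENNReal.ofReal_mul (by positivity), ← ENNReal.ofReal_add (by positivity) h1,
          ← ENNReal.ofReal_add (by positivity) (by positivity)]
        congr 1
        ring

lemma IsGapSeq.hasLowerContent_hyperbolaFamily {m r δ : ℝ} (hm : 1 ≤ m) (hr : 0 < r)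
    {t : ℕ → ℝ} (h : IsGapSeq m t) (hδ : IsLowerExponent t δ) :
    HasLowerContent 2 (hyperbolaFamily r t) (1 + δ) := by
  obtain ⟨c, hc, hC⟩ := hδ
  obtain ⟨n₀, hgap⟩ := h.gap
  obtain ⟨c', hc', H⟩ := exists_le_volume_thickening_range hm 0
  obtain ⟨n₁, hn₁⟩ := eventually_atTop.1
    (h.lim.eventually_le_const (Real.rpow_pos_of_pos (by norm_num : (0 : ℝ) < 1 / 2) r))
  set M := max n₀ n₁ with hM
  refine ⟨c' * (c / (M + 1)) * (1 / 2), by positivity, fun ε hε => ?_⟩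
  have hε0 := hε.1
  have hp : 0 < ε ^ (1 - δ) := Real.rpow_pos_of_pos hε0 _
  have hexp : (2 : ℝ) - (1 + δ) = 1 - δ := by ring
  rw [hexp]
  have hslice : ∀ x ∈ Ioo (1 / 2 : ℝ) 1, ENNReal.ofReal (c' * (c / (M + 1)) * ε ^ (1 - δ)) ≤
      volume (Prod.mk x ⁻¹' thickening ε (hyperbolaFamily r t)) := by
    rintro x ⟨hx1, hx2⟩
    have hx0 : 0 < x := by linarith
    have hxr : 0 < x ^ r := Real.rpow_pos_of_pos hx0 r
    have hxr1 : x ^ r ≤ 1 := Real.rpow_le_one hx0.le hx2.le hr.le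
    set l := (x ^ r)⁻¹ with hl
    have hl0 : 0 < l := inv_pos.2 hxr
    have hl1 : 1 ≤ l := (one_le_inv₀ hxr).2 hxr1
    obtain ⟨k, hk⟩ := H (fun n => l * t (n + M)) (fun n => mul_pos hl0 (h.pos _))
      (fun a b hab => mul_lt_mul_of_pos_left (h.anti (by omega)) hl0)
      (by simpa using (h.lim.comp (tendsto_add_atTop_nat M)).const_mul l)
      (fun n _ => by
        have h1 := hgap (n + M) ((le_max_left _ _).trans (Nat.le_add_left _ _))
        have h2 : n + 1 + M = n + M + 1 := by ring
        have h3 : n + 2 + M = n + M + 2 := by ring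
        simp only [Real.mul_rpow hl0.le (h.pos _).le, ← mul_sub, h2, h3]
        exact mul_le_mul_of_nonneg_left h1 (Real.rpow_nonneg hl0.le _)) ε hε0
    refine le_trans (ENNReal.ofReal_le_ofReal ?_) (hk.trans (measure_mono ?_))
    · rw [mul_assoc]
      refine mul_le_mul_of_nonneg_left ?_ hc'.le
      rw [div_mul_eq_mul_div, div_le_iff₀ (by positivity)]
      have h1 := hC ε hε (k + M)
      push_cast at h1
      have htp := h.pos (k + M)
      have h2 : t (k + M) ≤ l * t (k + M) := le_mul_of_one_le_left htp.le hl1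
      have h3 : (0 : ℝ) ≤ M * (l * t (k + M)) := by positivity
      have h4 : (0 : ℝ) ≤ M * k * ε := by positivity
      nlinarith
    · intro y hy
      obtain ⟨_, ⟨n, rfl⟩, hd⟩ := mem_thickening_iff.1 hy
      refine mem_thickening_iff.2 ⟨(x, l * t (n + M)),
        ⟨⟨hx0, hx2.le⟩, ⟨mul_pos hl0 (h.pos _), ?_⟩, n + M, ?_⟩, ?_⟩
      · simp only
        rw [inv_mul_le_iff₀ hxr, mul_one]
        exact (hn₁ _ ((le_max_right _ _).trans (Nat.le_add_left _ _))).trans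
          (Real.rpow_le_rpow (by norm_num) hx1.le hr.le)
      · simp only
        rw [mul_inv_cancel_left₀ hxr.ne']
      · rw [Prod.dist_eq, dist_self]
        exact max_lt hε0 hd
  rw [Measure.volume_eq_prod, Measure.prod_apply isOpen_thickening.measurableSet]
  calc ENNReal.ofReal (c' * (c / (M + 1)) * (1 / 2) * ε ^ (1 - δ))
      = ∫⁻ _ in Ioo (1 / 2 : ℝ) 1, ENNReal.ofReal (c' * (c / (M + 1)) * ε ^ (1 - δ)) := by
        rw [setLIntegral_const, Real.volume_Ioo, ← ENNReal.ofReal_mul (by positivity)]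
        congr 1
        ring
    _ ≤ ∫⁻ x in Ioo (1 / 2 : ℝ) 1,
          volume (Prod.mk x ⁻¹' thickening ε (hyperbolaFamily r t)) :=
        setLIntegral_mono' measurableSet_Ioo hslice
    _ ≤ _ := setLIntegral_le_lintegral _ _

/-- Exchanging the coordinates turns the exponent `r` into `1 / r`. -/
lemma HasLowerContent.swap_hyperbolaFamily {r N δ : ℝ} (hr : 0 < r) {s : ℕ → ℝ}
    (h : HasLowerContent N (hyperbolaFamily (1 / r) fun n => s n ^ (1 / r)) δ)
    (hs : ∀ n, 0 < s n) : HasLowerContent N (hyperbolaFamily r s) δ := by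
  obtain ⟨c, hc, hC⟩ := h
  refine ⟨c, hc, fun ε hε => (hC ε hε).trans ?_⟩
  have hmp : MeasurePreserving (Prod.swap : ℝ × ℝ → ℝ × ℝ) volume volume :=
    Measure.measurePreserving_swap
  rw [← hmp.measure_preimage isOpen_thickening.measurableSet.nullMeasurableSet]
  refine measure_mono fun p hp => ?_
  obtain ⟨q, ⟨hq1, hq2, n, hn⟩, hd⟩ := mem_thickening_iff.1 hp
  refine mem_thickening_iff.2 ⟨q.swap, ⟨hq2, hq1, n, ?_⟩, ?_⟩
  · simp only at hn
    have h1 : (s n ^ (1 / r)) ^ r = (q.1 ^ (1 / r) * q.2) ^ r := by rw [hn]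
    rw [Real.mul_rpow (Real.rpow_nonneg hq1.1.le _) hq2.1.le, ← Real.rpow_mul (hs n).le,
      ← Real.rpow_mul hq1.1.le, one_div_mul_cancel hr.ne', Real.rpow_one, Real.rpow_one] at h1
    rw [h1, mul_comm]
    rfl
  · rw [Prod.dist_eq] at hd ⊢
    rwa [max_comm]

lemma hasBoxDim_of_volume_bounds {m : ℝ} (hm : 1 ≤ m) {t : ℕ → ℝ} (h : IsGapSeq m t)
    {D : ℝ} (hD : HasBoxDim 1 (range t) D) {U : Set (ℝ × ℝ)}
    (hup : ∀ θ ∈ Ioo (0 : ℝ) 1, ∃ K > 0, ∀ ε ∈ Ioc (0 : ℝ) 1, ∀ n : ℕ,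
      volume (thickening ε U) ≤ ENNReal.ofReal (K * (t n ^ θ + (n + 1) * ε)))
    (hlow : ∀ δ, IsLowerExponent t δ → HasLowerContent 2 U (1 + δ)) :
    HasBoxDim 2 U (1 + D) := by
  rw [h.hasBoxDim_iff hm] at hD
  obtain ⟨⟨hD0, hD1⟩, hDup, hDlow⟩ := hD
  have hlow0 : HasLowerContent 2 U 1 := by
    have := hlow 0 ⟨1, one_pos, fun ε hε n => by
      rw [sub_zero, Real.rpow_one]
      have h1 := h.pos n
      have h2 : (0 : ℝ) ≤ n * ε := mul_nonneg (Nat.cast_nonneg n) hε.1.le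
      linarith⟩
    rwa [add_zero] at this
  rw [hasBoxDim_iff zero_le_two]
  · refine ⟨⟨by linarith, by linarith⟩, fun d hd => ?_, fun d hd => ?_⟩
    · obtain ⟨hd1, hd2⟩ := hd
      set δ := (D + (d - 1)) / 2 with hδ
      have hδ1 : 0 < 1 - δ := by rw [hδ]; linarith
      have hθ : (2 - d) / (1 - δ) ∈ Ioo (0 : ℝ) 1 :=
        ⟨div_pos (by linarith) hδ1, (div_lt_one hδ1).2 (by rw [hδ]; linarith)⟩
      set θ := (2 - d) / (1 - δ) with hθdef
      obtain ⟨K, hK, hKle⟩ := hup θ hθ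
      obtain ⟨C, hC⟩ := hDup δ ⟨by rw [hδ]; linarith, by linarith⟩
      have hC0 : 0 < C := by
        obtain ⟨n, hn⟩ := hC 1 ⟨one_pos, le_rfl⟩
        have := h.pos n
        rw [Real.one_rpow, mul_one, mul_one] at hn
        have : (0 : ℝ) ≤ n := Nat.cast_nonneg n
        linarith
      refine ⟨K * (C ^ θ + C), fun ε hε => ?_⟩
      obtain ⟨n, hn⟩ := hC ε hε
      refine (hKle ε hε n).trans (ENNReal.ofReal_le_ofReal ?_)
      have hε0 := hε.1
      have htn := h.pos n
      have h1 : 0 < ((n : ℝ) + 1) * ε := by positivity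
      have h2 : t n ^ θ ≤ C ^ θ * ε ^ (2 - d) := by
        calc t n ^ θ ≤ (C * ε ^ (1 - δ)) ^ θ :=
              Real.rpow_le_rpow htn.le (by linarith) hθ.1.le
          _ = _ := by
              rw [Real.mul_rpow hC0.le (by positivity), ← Real.rpow_mul hε0.le, hθdef,
                mul_div_cancel₀ _ hδ1.ne']
      have h3 : ((n : ℝ) + 1) * ε ≤ C * ε ^ (2 - d) := by
        calc ((n : ℝ) + 1) * ε ≤ C * ε ^ (1 - δ) := by linarith
          _ ≤ _ := mul_le_mul_of_nonneg_left
              (Real.rpow_le_rpow_of_exponent_ge hε0 hε.2 (by rw [hδ]; linarith)) hC0.le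
      rw [mul_assoc]
      refine mul_le_mul_of_nonneg_left ?_ hK.le
      linarith
    · rcases le_or_gt d 1 with hd1 | hd1
      · exact hlow0.mono hd1
      · have := hlow (d - 1) (hDlow (d - 1) ⟨by linarith, by linarith [hd.2]⟩)
        rwa [add_sub_cancel] at this
  · obtain ⟨K, -, hK⟩ := hup (1 / 2) ⟨by norm_num, by norm_num⟩
    exact ne_top_of_le_ne_top ENNReal.ofReal_ne_top (hK 1 ⟨one_pos, le_rfl⟩ 0)
  · intro ε hε
    obtain ⟨c, hc, hC⟩ := hlow0
    have hmin : 0 < min ε 1 := lt_min hε one_pos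
    refine lt_of_lt_of_le (ENNReal.ofReal_pos.2 (mul_pos hc (Real.rpow_pos_of_pos hmin (2 - 1))))
      ((hC (min ε 1) ⟨hmin, min_le_right _ _⟩).trans
        (measure_mono (thickening_mono (min_le_left _ _) U)))

end Plane

lemma IsGapSeq.hasBoxDim_hyperbolaFamily {m r : ℝ} (hm : 1 ≤ m) (hr : 0 < r) (hrm : r ≤ m)
    {s : ℕ → ℝ} (hs : IsGapSeq 1 s) {D : ℝ} (hD : HasBoxDim 1 (range fun n => s n ^ (1 / m)) D)
    (hlow : ∀ δ, IsLowerExponent (fun n => s n ^ (1 / m)) δ →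
      HasLowerContent 2 (hyperbolaFamily r s) (1 + δ)) :
    HasBoxDim 2 (hyperbolaFamily r s) (1 + D) := by
  refine hasBoxDim_of_volume_bounds hm (hs.rpow_inv hm) hD (fun θ hθ => ?_) hlow
  have hm0 : 0 < m := by linarith
  have h1 : r * (θ / m) ≤ θ := by
    rw [mul_div_assoc', div_le_iff₀ hm0, mul_comm]
    exact mul_le_mul_of_nonneg_left hrm hθ.1.le
  have h2 : 0 < 1 - r * (θ / m) := by linarith [hθ.2]
  refine ⟨(1 - r * (θ / m))⁻¹ + 12, by positivity, fun ε hε n => ?_⟩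
  have hθm : θ / m ∈ Ioc (0 : ℝ) 1 :=
    ⟨div_pos hθ.1 hm0, (div_le_one hm0).2 (hθ.2.le.trans hm)⟩
  refine (volume_thickening_hyperbolaFamily_le hr hs.pos hs.anti.antitone hθm (by linarith)
    hε n).trans (ENNReal.ofReal_le_ofReal ?_)
  have hε0 := hε.1
  have hsn := hs.pos n
  have h3 : (s n ^ (1 / m)) ^ θ = s n ^ (θ / m) := by
    rw [← Real.rpow_mul hsn.le, one_div_mul_eq_div]
  have h4 : 0 < s n ^ (θ / m) := Real.rpow_pos_of_pos hsn _
  have h5 : 0 < (1 - r * (θ / m))⁻¹ * (((n : ℝ) + 1) * ε) := by positivity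
  rw [h3, div_eq_inv_mul]
  linarith

/-- Box dimension of a family of hyperbolas `H_{r,S} = {(x,y) ∈ (0,1]² : x^r y ∈ S}`,
where `S = {s_n} ⊂ (0,1]` is a strictly decreasing sequence converging to `0` with
eventually decreasing consecutive distances, whose box dimension exists.
Then `dim_B H_{r,S}` exists and equals `1 + dim_B S` if `r ≤ 1`, and
`1 + dim_B (S^{1/r})` if `r > 1` (where `dim_B (S^{1/r})` exists as well). -/
theorem boxDim_hyperbola_family (r : ℝ) (hr : 0 < r) (s : ℕ → ℝ)
    (hmem : ∀ n, s n ∈ Set.Ioc (0:ℝ) 1)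
    (hanti : StrictAnti s)
    (hlim : Tendsto s atTop (nhds 0))
    (hdist : ∃ n₀ : ℕ, ∀ n ≥ n₀, s (n + 1) - s (n + 2) ≤ s n - s (n + 1))
    (dS : ℝ) (hdS : HasBoxDim 1 (Set.range s) dS) :
    (r ≤ 1 →
      HasBoxDim 2 {p : ℝ × ℝ | p.1 ∈ Set.Ioc (0:ℝ) 1 ∧ p.2 ∈ Set.Ioc (0:ℝ) 1 ∧
        p.1 ^ r * p.2 ∈ Set.range s} (1 + dS)) ∧
    (1 < r →
      ∃ dS' : ℝ, HasBoxDim 1 ((fun c : ℝ => c ^ (1 / r)) '' Set.range s) dS' ∧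
        HasBoxDim 2 {p : ℝ × ℝ | p.1 ∈ Set.Ioc (0:ℝ) 1 ∧ p.2 ∈ Set.Ioc (0:ℝ) 1 ∧
          p.1 ^ r * p.2 ∈ Set.range s} (1 + dS')) := by
  have hs : IsGapSeq 1 s :=
    ⟨fun n => (hmem n).1, hanti, hlim, by simpa only [Real.rpow_one] using hdist⟩
  refine ⟨fun hr1 => ?_, fun hr1 => ⟨r * dS / (r * dS + 1 - dS), ?_, ?_⟩⟩
  · refine hs.hasBoxDim_hyperbolaFamily le_rfl hr hr1 (by simpa using hdS) fun δ hδ => ?_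
    exact hs.hasLowerContent_hyperbolaFamily le_rfl hr (by simpa using hδ)
  · rw [← range_comp]
    exact hs.hasBoxDim_rpow_inv hr1.le hdS
  · refine hs.hasBoxDim_hyperbolaFamily hr1.le hr le_rfl
      (hs.hasBoxDim_rpow_inv hr1.le hdS) fun δ hδ => ?_
    exact ((hs.rpow_inv hr1.le).hasLowerContent_hyperbolaFamily hr1.le (by positivity)
      hδ).swap_hyperbolaFamily hr hs.pos
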